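/- For n = 4m+2, write A_n(t) = Σ_i γ^S_{n,i} t^i(1+t)^{n-1-2i} and A_n^+(t) = f_1(t) + f_2(t), where f_1 = Σ_i γ^{A,1}_{n,i} t^i(1+t)^{4m-2i} and f_2 = Σ_i γ^{A,2}_{n,i} t^i(1+t)^{4m+2-2i} are the gamma positive summands arising from the decomposition. Then γ^S_{n,i-1} = γ^{A,1}_{n,i-1} + γ^{A,2}_{n,i} for all i. -/

import Mathlib

open Finset

/-- number of descents of a permutation of `Fin n` (one-line notation). -/
def desA {n : ℕ} (π : Equiv.Perm (Fin n)) : ℕ :=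
  (Finset.univ.filter (fun i : Fin (n-1) =>
    π ⟨i.1+1, by have := i.2; omega⟩ < π ⟨i.1, by have := i.2; omega⟩)).card

/-- number of ascents. -/
def ascA {n : ℕ} (π : Equiv.Perm (Fin n)) : ℕ :=
  (Finset.univ.filter (fun i : Fin (n-1) =>
    π ⟨i.1, by have := i.2; omega⟩ < π ⟨i.1+1, by have := i.2; omega⟩)).card

/-- number of inversions. -/
def invA {n : ℕ} (π : Equiv.Perm (Fin n)) : ℕ :=
  (Finset.univ.filter (fun p : Fin n × Fin n => p.1 < p.2 ∧ π p.2 < π p.1)).card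

/-- bivariate Eulerian polynomial over all of `S_n`; variable 0 is `s`, variable 1 is `t`. -/
noncomputable def Abiv (n : ℕ) : MvPolynomial (Fin 2) ℚ :=
  ∑ π : Equiv.Perm (Fin n), MvPolynomial.X 1 ^ desA π * MvPolynomial.X 0 ^ ascA π

noncomputable def AbivP (n : ℕ) : MvPolynomial (Fin 2) ℚ :=
  ∑ π ∈ Finset.univ.filter (fun π : Equiv.Perm (Fin n) => Equiv.Perm.sign π = 1),
    MvPolynomial.X 1 ^ desA π * MvPolynomial.X 0 ^ ascA π

noncomputable def AbivM (n : ℕ) : MvPolynomial (Fin 2) ℚ :=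
  ∑ π ∈ Finset.univ.filter (fun π : Equiv.Perm (Fin n) => Equiv.Perm.sign π = -1),
    MvPolynomial.X 1 ^ desA π * MvPolynomial.X 0 ^ ascA π

noncomputable def Auni (n : ℕ) : Polynomial ℚ :=
  ∑ π : Equiv.Perm (Fin n), Polynomial.X ^ desA π

noncomputable def AuniP (n : ℕ) : Polynomial ℚ :=
  ∑ π ∈ Finset.univ.filter (fun π : Equiv.Perm (Fin n) => Equiv.Perm.sign π = 1),
    Polynomial.X ^ desA π

noncomputable def AuniM (n : ℕ) : Polynomial ℚ :=
  ∑ π ∈ Finset.univ.filter (fun π : Equiv.Perm (Fin n) => Equiv.Perm.sign π = -1),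
    Polynomial.X ^ desA π

/-- the operator `∂/∂s + ∂/∂t`. -/
noncomputable def Dop (f : MvPolynomial (Fin 2) ℚ) : MvPolynomial (Fin 2) ℚ :=
  MvPolynomial.pderiv 0 f + MvPolynomial.pderiv 1 f

/-- A univariate polynomial is palindromic: with `r` the least exponent with nonzero
coefficient and `n` the degree, `a_{r+i} = a_{n-i}`. -/
def Palind (f : Polynomial ℚ) : Prop :=
  ∀ i ≤ f.natDegree - f.natTrailingDegree,
    f.coeff (f.natTrailingDegree + i) = f.coeff (f.natDegree - i)

/-- bivariate gamma positivity with center of symmetry `N/2`. -/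
def BivGamma (f : MvPolynomial (Fin 2) ℚ) (N : ℕ) : Prop :=
  ∃ γ : ℕ → ℕ, (∀ i, γ i ≠ 0 → 2*i ≤ N) ∧
    f = ∑ i ∈ Finset.range (N+1), (γ i : MvPolynomial (Fin 2) ℚ) *
      ((MvPolynomial.X 0 * MvPolynomial.X 1)^i * (MvPolynomial.X 0 + MvPolynomial.X 1)^(N - 2*i))

/-- univariate gamma positivity with center of symmetry `c2/2`. -/
def UniGamma (f : Polynomial ℚ) (c2 : ℕ) : Prop :=
  ∃ γ : ℕ → ℕ, (∀ i, γ i ≠ 0 → 2*i ≤ c2) ∧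
    f = ∑ i ∈ Finset.range (c2+1), (γ i : ℚ) •
      (Polynomial.X^i * (1 + Polynomial.X)^(c2 - 2*i))

/-- signed permutations: a permutation together with a sign for each position. -/
abbrev SignedPerm (n : ℕ) := Equiv.Perm (Fin n) × (Fin n → Bool)

/-- the one-line word of a signed permutation, 1-indexed, with `bw w 0 = 0`;
entry `i` is `±(w.1 i + 1)` viewed in `{-n,…,-1,1,…,n}`. -/
def bw {n : ℕ} (w : SignedPerm n) (i : ℕ) : ℤ :=
  if h : 1 ≤ i ∧ i ≤ n then
    (if w.2 ⟨i-1, by omega⟩ then -(((w.1 ⟨i-1, by omega⟩ : ℕ) : ℤ) + 1)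
     else ((w.1 ⟨i-1, by omega⟩ : ℕ) : ℤ) + 1)
  else 0

/-- type-B descents (including a possible descent at position 0). -/
def desB {n : ℕ} (w : SignedPerm n) : ℕ :=
  ((Finset.range n).filter (fun i => bw w (i+1) < bw w i)).card

/-- type-B inversions (length). -/
def invB {n : ℕ} (w : SignedPerm n) : ℕ :=
  (Finset.univ.filter (fun p : Fin n × Fin n => p.1 < p.2 ∧ bw w (p.2.1+1) < bw w (p.1.1+1))).card
  + (Finset.univ.filter (fun p : Fin n × Fin n => p.1 < p.2 ∧ bw w (p.2.1+1) < -(bw w (p.1.1+1)))).card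
  + (Finset.univ.filter (fun i : Fin n => bw w (i.1+1) < 0)).card

/-- type-D inversions. -/
def invD {n : ℕ} (w : SignedPerm n) : ℕ :=
  (Finset.univ.filter (fun p : Fin n × Fin n => p.1 < p.2 ∧ bw w (p.2.1+1) < bw w (p.1.1+1))).card
  + (Finset.univ.filter (fun p : Fin n × Fin n => p.1 < p.2 ∧ bw w (p.2.1+1) < -(bw w (p.1.1+1)))).card

noncomputable def Bbiv (n : ℕ) : MvPolynomial (Fin 2) ℚ :=
  ∑ w : SignedPerm n, MvPolynomial.X 1 ^ desB w * MvPolynomial.X 0 ^ (n - desB w)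

noncomputable def BbivP (n : ℕ) : MvPolynomial (Fin 2) ℚ :=
  ∑ w ∈ Finset.univ.filter (fun w : SignedPerm n => Even (invB w)),
    MvPolynomial.X 1 ^ desB w * MvPolynomial.X 0 ^ (n - desB w)

noncomputable def BbivM (n : ℕ) : MvPolynomial (Fin 2) ℚ :=
  ∑ w ∈ Finset.univ.filter (fun w : SignedPerm n => ¬ Even (invB w)),
    MvPolynomial.X 1 ^ desB w * MvPolynomial.X 0 ^ (n - desB w)

noncomputable def BuniP (n : ℕ) : Polynomial ℚ :=
  ∑ w ∈ Finset.univ.filter (fun w : SignedPerm n => Even (invB w)), Polynomial.X ^ desB w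

noncomputable def BuniM (n : ℕ) : Polynomial ℚ :=
  ∑ w ∈ Finset.univ.filter (fun w : SignedPerm n => ¬ Even (invB w)), Polynomial.X ^ desB w

/-- deleting the largest letter from the one-line notation of `π ∈ S_{n+1}`
gives a permutation of `[n]`. -/
noncomputable def restrictMax {n : ℕ} (π : Equiv.Perm (Fin (n+1))) : Equiv.Perm (Fin n) :=
  Equiv.ofBijective
    (fun i => Fin.castPred (π ((π.symm (Fin.last n)).succAbove i))
      (by
        intro h
        have h2 : (π.symm (Fin.last n)).succAbove i = π.symm (Fin.last n) := by
          apply π.injective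
          rw [h, Equiv.apply_symm_apply]
        exact Fin.succAbove_ne _ i h2))
    (Finite.injective_iff_bijective.mp (by
      intro i j h
      have h2 : π ((π.symm (Fin.last n)).succAbove i) = π ((π.symm (Fin.last n)).succAbove j) :=
        Fin.castPred_inj.mp h
      have h3 := π.injective h2
      exact Fin.succAbove_right_injective h3))

/-- number of even permutations of `[n]` with `k` descents (`k : ℤ`). -/
noncomputable def aP (n : ℕ) (k : ℤ) : ℕ :=
  (Finset.univ.filter (fun π : Equiv.Perm (Fin n) =>
    Equiv.Perm.sign π = 1 ∧ (desA π : ℤ) = k)).card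

/-- number of odd permutations of `[n]` with `k` descents. -/
noncomputable def aM (n : ℕ) (k : ℤ) : ℕ :=
  (Finset.univ.filter (fun π : Equiv.Perm (Fin n) =>
    Equiv.Perm.sign π = -1 ∧ (desA π : ℤ) = k)).card

open Polynomial in
/-- The polynomials `X ^ i * (1 + X) ^ e i` are linearly independent. -/
theorem eq_zero_of_sum_smul_X_pow_mul_one_add_X_pow (k : ℕ) :
    ∀ (c : ℕ → ℚ) (e : ℕ → ℕ),
      ∑ i ∈ Finset.range k, c i • ((X : ℚ[X]) ^ i * (1 + X) ^ e i) = 0 →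
      ∀ i < k, c i = 0 := by
  induction k with
  | zero => intro c e _ i hi; omega
  | succ k ih =>
    intro c e h
    rw [Finset.sum_range_succ'] at h
    have h0 : c 0 = 0 := by
      simpa [eval_finsetSum] using congrArg (Polynomial.eval 0) h
    have h1 : X * ∑ i ∈ Finset.range k, c (i + 1) • ((X : ℚ[X]) ^ i * (1 + X) ^ e (i + 1)) = 0 := by
      rw [← h, h0, zero_smul, add_zero, Finset.mul_sum]
      refine Finset.sum_congr rfl fun i _ => ?_
      rw [mul_smul_comm, pow_succ]
      congr 1
      ring
    have h2 := ih (fun i => c (i + 1)) (fun i => e (i + 1))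
      ((mul_eq_zero.mp h1).resolve_left X_ne_zero)
    intro i hi
    cases i with
    | zero => exact h0
    | succ i => exact h2 i (by omega)

/-- The number of descents `w (i + 1) < w i`, `i < k`, of a word `w`. -/
def wordDes (k : ℕ) (w : ℕ → ℕ) : ℕ := ∑ i ∈ Finset.range k, if w (i + 1) < w i then 1 else 0

/-- Insert the letter `a` at position `p` of the word `w`. -/
def wordInsert (w : ℕ → ℕ) (a p : ℕ) (i : ℕ) : ℕ :=
  if i < p then w i else if i = p then a else w (i - 1)

theorem wordInsert_of_lt (w : ℕ → ℕ) (a : ℕ) {p i : ℕ} (h : i < p) : wordInsert w a p i = w i :=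
  if_pos h

theorem wordInsert_self (w : ℕ → ℕ) (a p : ℕ) : wordInsert w a p p = a := by
  simp [wordInsert]

theorem wordInsert_succ_of_le (w : ℕ → ℕ) (a : ℕ) {p i : ℕ} (h : p ≤ i) :
    wordInsert w a p (i + 1) = w i := by
  simp [wordInsert, show ¬ i + 1 < p by omega, show i + 1 ≠ p by omega]

theorem wordDes_congr {k : ℕ} {w v : ℕ → ℕ} (h : ∀ i ≤ k, w i = v i) :
    wordDes k w = wordDes k v := by
  refine Finset.sum_congr rfl fun i hi => ?_
  have := Finset.mem_range.mp hi
  rw [h i (by omega), h (i + 1) (by omega)]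

theorem wordDes_wordInsert_zero {k a : ℕ} {w : ℕ → ℕ} (h : ∀ i ≤ k, w i < a) :
    wordDes (k + 1) (wordInsert w a 0) = wordDes k w + 1 := by
  unfold wordDes
  rw [Finset.sum_range_succ']
  simp [wordInsert, h 0]

theorem wordDes_wordInsert_last {k a : ℕ} {w : ℕ → ℕ} (h : ∀ i ≤ k, w i < a) :
    wordDes (k + 1) (wordInsert w a (k + 1)) = wordDes k w := by
  unfold wordDes
  rw [Finset.sum_range_succ]
  rw [wordInsert_self, wordInsert_of_lt w a (lt_add_one k), if_neg (h k le_rfl).not_gt, add_zero]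
  refine Finset.sum_congr rfl fun i hi => ?_
  have := Finset.mem_range.mp hi
  rw [wordInsert_of_lt w a (by omega : i + 1 < k + 1),
    wordInsert_of_lt w a (by omega : i < k + 1)]

theorem wordDes_wordInsert_succ {k a q : ℕ} {w : ℕ → ℕ} (h : ∀ i ≤ k, w i < a) (hq : q < k) :
    wordDes (k + 1) (wordInsert w a (q + 1)) + (if w (q + 1) < w q then 1 else 0)
      = wordDes k w + 1 := by
  obtain ⟨r, rfl⟩ : ∃ r, k = q + 1 + r := ⟨k - (q + 1), by omega⟩
  unfold wordDes
  rw [show q + 1 + r + 1 = q + 1 + 1 + r by ring, Finset.sum_range_add _ (q + 1 + 1),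
    Finset.sum_range_succ _ (q + 1), Finset.sum_range_succ _ q, Finset.sum_range_add _ (q + 1) r,
    Finset.sum_range_succ _ q]
  have h1 : ∑ i ∈ Finset.range q, (if wordInsert w a (q + 1) (i + 1) < wordInsert w a (q + 1) i
      then 1 else 0) = ∑ i ∈ Finset.range q, if w (i + 1) < w i then 1 else 0 := by
    refine Finset.sum_congr rfl fun i hi => ?_
    have := Finset.mem_range.mp hi
    rw [wordInsert_of_lt w a (by omega : i + 1 < q + 1),
      wordInsert_of_lt w a (by omega : i < q + 1)]
  have h2 : ∑ i ∈ Finset.range r, (if wordInsert w a (q + 1) (q + 1 + 1 + i + 1) <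
      wordInsert w a (q + 1) (q + 1 + 1 + i) then 1 else 0)
      = ∑ i ∈ Finset.range r, if w (q + 1 + i + 1) < w (q + 1 + i) then 1 else 0 := by
    refine Finset.sum_congr rfl fun i hi => ?_
    rw [show q + 1 + 1 + i = q + 1 + i + 1 by ring, wordInsert_succ_of_le w a (by omega),
      wordInsert_succ_of_le w a (by omega)]
  have h3 : ¬ wordInsert w a (q + 1) (q + 1) < wordInsert w a (q + 1) q := by
    simpa [wordInsert] using (h q (by omega)).le
  have h4 : wordInsert w a (q + 1) (q + 1 + 1) < wordInsert w a (q + 1) (q + 1) := by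
    simpa [wordInsert] using h (q + 1) (by omega)
  rw [h1, h2, if_neg h3, if_pos h4]
  ring

open Polynomial in
theorem sum_X_pow_wordDes_wordInsert {k a : ℕ} {w : ℕ → ℕ} (h : ∀ i ≤ k, w i < a) :
    ∑ p ∈ Finset.range (k + 2), (X : ℚ[X]) ^ wordDes (k + 1) (wordInsert w a p)
      = (1 + (k + 1 : ℚ[X]) * X) * X ^ wordDes k w
        + X * (1 - X) * derivative (X ^ wordDes k w) := by
  have key : ∀ q ∈ Finset.range k, (X : ℚ[X]) ^ wordDes (k + 1) (wordInsert w a (q + 1))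
      = X ^ (wordDes k w + 1) +
        ((if w (q + 1) < w q then 1 else 0 : ℕ) : ℚ[X]) *
          (X ^ wordDes k w - X ^ (wordDes k w + 1)) := by
    intro q hq
    have := wordDes_wordInsert_succ h (Finset.mem_range.mp hq)
    split_ifs at this ⊢ with hd
    · rw [show wordDes (k + 1) (wordInsert w a (q + 1)) = wordDes k w by omega]
      push_cast
      ring
    · rw [show wordDes (k + 1) (wordInsert w a (q + 1)) = wordDes k w + 1 by omega]
      push_cast
      ring
  rw [Finset.sum_range_succ, Finset.sum_range_succ', wordDes_wordInsert_zero h,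
    wordDes_wordInsert_last h, Finset.sum_congr rfl key, Finset.sum_add_distrib,
    ← Finset.sum_mul, ← Nat.cast_sum]
  change _ + ((wordDes k w : ℕ) : ℚ[X]) * _ + _ + _ = _
  rw [Finset.sum_const, Finset.card_range, nsmul_eq_mul, derivative_X_pow]
  rcases Nat.eq_zero_or_pos (wordDes k w) with h0 | h0
  · rw [h0]
    simp
    ring
  · obtain ⟨d, hd⟩ : ∃ d, wordDes k w = d + 1 := ⟨wordDes k w - 1, by omega⟩
    rw [hd]
    simp
    ring

/-- The one-line notation of a permutation, extended by zero. -/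
def permWord {n : ℕ} (π : Equiv.Perm (Fin n)) (i : ℕ) : ℕ :=
  if h : i < n then (π ⟨i, h⟩ : ℕ) else 0

theorem desA_eq_wordDes {k : ℕ} (π : Equiv.Perm (Fin (k + 1))) :
    desA π = wordDes k (permWord π) := by
  unfold desA wordDes
  rw [Finset.card_filter]
  change ∑ i : Fin k, _ = _
  rw [Finset.sum_range]
  refine Finset.sum_congr rfl fun i _ => ?_
  have := i.2
  unfold permWord
  rw [dif_pos (by omega), dif_pos (by omega)]
  rfl

/-- Insert the largest letter at position `p` of a permutation. -/
def insertMax {n : ℕ} (p : Fin (n + 1)) (σ : Equiv.Perm (Fin n)) : Equiv.Perm (Fin (n + 1)) :=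
  ((finSuccEquiv' p).trans (Equiv.optionCongr σ)).trans (finSuccEquiv' (Fin.last n)).symm

theorem insertMax_self {n : ℕ} (p : Fin (n + 1)) (σ : Equiv.Perm (Fin n)) :
    insertMax p σ p = Fin.last n := by
  simp [insertMax]

theorem insertMax_succAbove {n : ℕ} (p : Fin (n + 1)) (σ : Equiv.Perm (Fin n)) (i : Fin n) :
    insertMax p σ (p.succAbove i) = (σ i).castSucc := by
  simp [insertMax]

theorem insertMax_bijective (n : ℕ) :
    Function.Bijective (fun x : Fin (n + 1) × Equiv.Perm (Fin n) => insertMax x.1 x.2) := by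
  rw [Fintype.bijective_iff_injective_and_card]
  refine ⟨?_, ?_⟩
  · rintro ⟨p, σ⟩ ⟨q, τ⟩ h
    dsimp only at h
    obtain rfl : p = q := by
      apply (insertMax q τ).injective
      rw [insertMax_self, ← h, insertMax_self]
    congr 1
    ext i
    have := insertMax_succAbove p τ i
    rw [← h, insertMax_succAbove] at this
    exact congrArg Fin.val (Fin.castSucc_injective _ this)
  · simp [Fintype.card_perm, Nat.factorial_succ]

theorem permWord_insertMax {n : ℕ} (p : Fin (n + 1)) (σ : Equiv.Perm (Fin n)) {i : ℕ}
    (hi : i ≤ n) : permWord (insertMax p σ) i = wordInsert (permWord σ) n p i := by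
  have hp := p.2
  have hL : permWord (insertMax p σ) i = (insertMax p σ ⟨i, by omega⟩ : ℕ) := dif_pos _
  rw [hL]
  rcases lt_trichotomy i p with h | h | h
  · have : (⟨i, by omega⟩ : Fin (n + 1)) = p.succAbove ⟨i, by omega⟩ := by
      rw [Fin.succAbove_of_castSucc_lt _ _ (by simpa [Fin.lt_def] using h)]
      rfl
    rw [wordInsert_of_lt _ _ h, this, insertMax_succAbove]
    unfold permWord
    rw [dif_pos (by omega)]
    rfl
  · have : (⟨i, by omega⟩ : Fin (n + 1)) = p := Fin.ext h
    rw [this, insertMax_self, h, wordInsert_self]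
    rfl
  · obtain ⟨j, rfl⟩ : ∃ j, i = j + 1 := ⟨i - 1, by omega⟩
    have : (⟨j + 1, by omega⟩ : Fin (n + 1)) = p.succAbove ⟨j, by omega⟩ := by
      rw [Fin.succAbove_of_le_castSucc _ _ (by simp only [Fin.le_def, Fin.val_castSucc]; omega)]
      rfl
    rw [wordInsert_succ_of_le _ _ (by omega), this, insertMax_succAbove]
    unfold permWord
    rw [dif_pos (by omega)]
    rfl

open Polynomial in
/-- The recurrence of the Eulerian polynomials. -/
theorem Auni_succ_succ (k : ℕ) :
    Auni (k + 2) = (1 + (k + 1 : ℚ[X]) * X) * Auni (k + 1)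
      + X * (1 - X) * derivative (Auni (k + 1)) := by
  unfold Auni
  rw [← (insertMax_bijective (k + 1)).sum_comp (fun π => (X : ℚ[X]) ^ desA π),
    Fintype.sum_prod_type_right, derivative_sum, Finset.mul_sum, Finset.mul_sum,
    ← Finset.sum_add_distrib]
  refine Finset.sum_congr rfl fun σ _ => ?_
  have hw : ∀ i ≤ k, permWord σ i < k + 1 := by
    intro i hi
    unfold permWord
    rw [dif_pos (by omega)]
    exact (σ _).2
  rw [desA_eq_wordDes σ, ← sum_X_pow_wordDes_wordInsert hw, Finset.sum_range]
  refine Finset.sum_congr rfl fun p _ => ?_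
  rw [desA_eq_wordDes, wordDes_congr fun i hi => permWord_insertMax p σ hi]

theorem AuniP_add_AuniM (n : ℕ) : AuniP n + AuniM n = Auni n := by
  unfold AuniP AuniM Auni
  rw [← Finset.sum_filter_add_sum_filter_not Finset.univ
    (fun π : Equiv.Perm (Fin n) => Equiv.Perm.sign π = 1)]
  congr 2
  ext π
  rcases Int.units_eq_one_or (Equiv.Perm.sign π) with h | h <;> simp [h]

open Polynomial in
/-- The operator of the Eulerian recurrence acts on the gamma basis. -/
theorem eulerian_operator_gamma_basis (i f : ℕ) (c : ℚ) :
    (1 + ((2 * i + 2 * f : ℕ) + 1 : ℚ[X]) * X) * (c • (X ^ i * (1 + X) ^ (2 * f)))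
      + X * (1 - X) * derivative (c • ((X : ℚ[X]) ^ i * (1 + X) ^ (2 * f)))
    = (1 + X) * (c • (X ^ i * (1 + X) ^ (2 * f))
      + 2 * (((i : ℚ) / 2 * c) • (X ^ i * (1 + X) ^ (2 * f)))
      + 2 * ((((2 * f : ℕ) : ℚ) * c) • (X ^ (i + 1) * (1 + X) ^ (2 * f - 2)))) := by
  have hX : (X : ℚ[X]) * derivative ((X : ℚ[X]) ^ i) = (i : ℚ[X]) * X ^ i := by
    cases i with
    | zero => simp
    | succ i =>
      rw [derivative_X_pow, map_natCast, Nat.add_sub_cancel]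
      ring
  have hC : (2 : ℚ[X]) * C ((i : ℚ) / 2) = (i : ℚ[X]) := by
    rw [← map_natCast (C : ℚ →+* ℚ[X]) i, ← map_ofNat (C : ℚ →+* ℚ[X]) 2, ← map_mul]
    congr 1
    ring
  cases f with
  | zero =>
    simp only [smul_eq_C_mul, derivative_C_mul, map_mul, Nat.mul_zero, pow_zero, mul_one,
      Nat.cast_zero, map_zero]
    push_cast
    linear_combination (C c * (1 - X)) * hX - (C c * (1 + X) * X ^ i) * hC
  | succ f =>
    have hU : derivative ((1 + X : ℚ[X]) ^ (2 * (f + 1)))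
        = (2 * (f + 1) : ℚ[X]) * (1 + X) ^ (2 * f + 1) := by
      rw [derivative_pow, show 2 * (f + 1) - 1 = 2 * f + 1 by omega]
      simp [← C_ofNat]
    rw [derivative_smul, derivative_mul, hU]
    simp only [smul_eq_C_mul, map_mul, map_natCast, show 2 * (f + 1) - 2 = 2 * f by omega]
    push_cast
    linear_combination (C c * (1 - X) * (1 + X) ^ (2 * (f + 1))) * hX
      - (C c * (1 + X) * X ^ i * (1 + X) ^ (2 * (f + 1))) * hC

theorem gamma_coeffs_add_up (m : ℕ) (hm : 1 ≤ m) (δ γS γ1 γ2 : ℕ → ℚ)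
    (f1 f2 : Polynomial ℚ)
    (hδ : Auni (4*m+1) = ∑ i ∈ Finset.range (2*m+1), δ i •
      (Polynomial.X^i * (1 + Polynomial.X)^(4*m - 2*i)))
    (hf1 : f1 = AuniP (4*m+1)
      + ∑ i ∈ Finset.range (2*m+1), ((i : ℚ)/2 * δ i) •
          (Polynomial.X^i * (1 + Polynomial.X)^(4*m - 2*i))
      + ∑ i ∈ Finset.range (2*m+1), (((4*m - 2*i : ℕ) : ℚ) * δ i) •
          (Polynomial.X^(i+1) * (1 + Polynomial.X)^(4*m - 2*i - 2)))
    (hf2 : f2 = Polynomial.X * AuniM (4*m+1)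
      + ∑ i ∈ Finset.range (2*m+1), ((i : ℚ)/2 * δ i) •
          (Polynomial.X^(i+1) * (1 + Polynomial.X)^(4*m - 2*i))
      + ∑ i ∈ Finset.range (2*m+1), (((4*m - 2*i : ℕ) : ℚ) * δ i) •
          (Polynomial.X^(i+2) * (1 + Polynomial.X)^(4*m - 2*i - 2)))
    (hγS : Auni (4*m+2) = ∑ i ∈ Finset.range (2*m+1), γS i •
      (Polynomial.X^i * (1 + Polynomial.X)^(4*m+1 - 2*i)))
    (hγ1 : f1 = ∑ i ∈ Finset.range (2*m+1), γ1 i •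
      (Polynomial.X^i * (1 + Polynomial.X)^(4*m - 2*i)))
    (hγ2 : f2 = ∑ i ∈ Finset.range (2*m+2), γ2 i •
      (Polynomial.X^i * (1 + Polynomial.X)^(4*m+2 - 2*i)))
    (i : ℕ) (hi : 1 ≤ i) (hi2 : i ≤ 2*m+1) :
    γS (i-1) = γ1 (i-1) + γ2 i := by
  have hrec : Auni (4 * m + 2) = (1 + Polynomial.X) * (Auni (4 * m + 1)
      + 2 * ∑ i ∈ Finset.range (2*m+1), ((i : ℚ)/2 * δ i) •
          (Polynomial.X^i * (1 + Polynomial.X)^(4*m - 2*i))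
      + 2 * ∑ i ∈ Finset.range (2*m+1), (((4*m - 2*i : ℕ) : ℚ) * δ i) •
          (Polynomial.X^(i+1) * (1 + Polynomial.X)^(4*m - 2*i - 2))) := by
    rw [Auni_succ_succ (4 * m), hδ, Polynomial.derivative_sum, Finset.mul_sum, Finset.mul_sum,
      Finset.mul_sum, Finset.mul_sum, ← Finset.sum_add_distrib, ← Finset.sum_add_distrib,
      ← Finset.sum_add_distrib, Finset.mul_sum]
    refine Finset.sum_congr rfl fun j hj => ?_
    have hj' := Finset.mem_range.mp hj
    have h1 : 4 * m - 2 * j = 2 * (2 * m - j) := by omega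
    have h2 : 4 * m = 2 * j + 2 * (2 * m - j) := by omega
    have := eulerian_operator_gamma_basis j (2 * m - j) (δ j)
    rw [← h2, ← h1] at this
    exact this
  have hmain : (1 + Polynomial.X) * (Polynomial.X * f1 + f2)
      = Polynomial.X * Auni (4 * m + 2) := by
    have hshift1 : ∑ i ∈ Finset.range (2*m+1), ((i : ℚ)/2 * δ i) •
          ((Polynomial.X : Polynomial ℚ)^(i+1) * (1 + Polynomial.X)^(4*m - 2*i))
        = Polynomial.X * ∑ i ∈ Finset.range (2*m+1), ((i : ℚ)/2 * δ i) •
          (Polynomial.X^i * (1 + Polynomial.X)^(4*m - 2*i)) := by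
      rw [Finset.mul_sum]
      refine Finset.sum_congr rfl fun j _ => ?_
      rw [mul_smul_comm, pow_succ', mul_assoc]
    have hshift2 : ∑ i ∈ Finset.range (2*m+1), (((4*m - 2*i : ℕ) : ℚ) * δ i) •
          ((Polynomial.X : Polynomial ℚ)^(i+2) * (1 + Polynomial.X)^(4*m - 2*i - 2))
        = Polynomial.X * ∑ i ∈ Finset.range (2*m+1), (((4*m - 2*i : ℕ) : ℚ) * δ i) •
          (Polynomial.X^(i+1) * (1 + Polynomial.X)^(4*m - 2*i - 2)) := by
      rw [Finset.mul_sum]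
      refine Finset.sum_congr rfl fun j _ => ?_
      rw [mul_smul_comm, pow_succ' _ (j + 1), mul_assoc]
    rw [hrec, hf1, hf2, hshift1, hshift2, ← AuniP_add_AuniM]
    ring
  have hzero : ∑ j ∈ Finset.range (2 * m + 2),
      (γ2 j + if j = 0 then 0 else γ1 (j - 1) - γS (j - 1)) •
        ((Polynomial.X : Polynomial ℚ) ^ j * (1 + Polynomial.X) ^ (4 * m + 3 - 2 * j)) = 0 := by
    have h2 : ∑ j ∈ Finset.range (2 * m + 2), γ2 j •
        ((Polynomial.X : Polynomial ℚ) ^ j * (1 + Polynomial.X) ^ (4 * m + 3 - 2 * j))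
        = (1 + Polynomial.X) * f2 := by
      rw [hγ2, Finset.mul_sum]
      refine Finset.sum_congr rfl fun j hj => ?_
      have := Finset.mem_range.mp hj
      rw [show 4 * m + 3 - 2 * j = 4 * m + 2 - 2 * j + 1 by omega, mul_smul_comm]
      congr 1
      ring
    have h1 : ∑ j ∈ Finset.range (2 * m + 2), (if j = 0 then 0 else γ1 (j - 1) - γS (j - 1)) •
        ((Polynomial.X : Polynomial ℚ) ^ j * (1 + Polynomial.X) ^ (4 * m + 3 - 2 * j))
        = (1 + Polynomial.X) * (Polynomial.X * f1) - Polynomial.X * Auni (4 * m + 2) := by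
      rw [Finset.sum_range_succ', if_pos rfl, zero_smul, add_zero, hγ1, hγS, Finset.mul_sum,
        Finset.mul_sum, Finset.mul_sum, ← Finset.sum_sub_distrib]
      refine Finset.sum_congr rfl fun j hj => ?_
      have := Finset.mem_range.mp hj
      rw [if_neg (Nat.succ_ne_zero j), Nat.add_sub_cancel,
        show 4 * m + 3 - 2 * (j + 1) = 4 * m - 2 * j + 1 by omega,
        show 4 * m + 1 - 2 * j = 4 * m - 2 * j + 1 by omega]
      simp only [Polynomial.smul_eq_C_mul, map_sub]
      ring
    simp only [add_smul]
    rw [Finset.sum_add_distrib, h1, h2]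
    linear_combination hmain
  have h := eq_zero_of_sum_smul_X_pow_mul_one_add_X_pow _ _ _ hzero i (by omega)
  rw [if_neg (by omega)] at h
  linarith
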